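/- Let G ∈ S_n^{r,t} be a connected bicyclic graph of order n = 9 whose two cycles have lengths r and t and share exactly one common vertex. Then ABC_GG(G) ≤ 2·sqrt(2/3) + 2·sqrt(6/15) + 2·sqrt(4/5) + 4·sqrt(7/8), with equality if and only if G = S_9^{3,3}(2, 2, 0). -/

import Mathlib

/-- `sideCount G u v` is the number of vertices of `G` whose distance to `u`
is strictly smaller than their distance to `v`. -/
noncomputable def sideCount {V : Type*} [Fintype V] (G : SimpleGraph V) (u v : V) : ℕ :=
  Nat.card {w : V // G.dist w u < G.dist w v}

open Classical in
/-- The Graovac–Ghorbani index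
`ABC_GG(G) = Σ_{uv ∈ E(G)} sqrt ((n_u + n_v - 2) / (n_u * n_v))`,
computed as half the sum over ordered adjacent pairs. -/
noncomputable def ABCGG {V : Type*} [Fintype V] (G : SimpleGraph V) : ℝ :=
  (1 / 2) * ∑ u : V, ∑ v : V,
    if G.Adj u v then
      Real.sqrt (((sideCount G u v : ℝ) + (sideCount G v u : ℝ) - 2) /
        ((sideCount G u v : ℝ) * (sideCount G v u : ℝ)))
    else 0

/-- `G ∈ S_n^{r,t}`: `G` is a bicyclic graph of order `n` possessing two cycles, of
lengths `r` and `t`, sharing exactly one common vertex. -/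
def InSnrt {V : Type*} [Fintype V] (G : SimpleGraph V) (n r t : ℕ) : Prop :=
  Fintype.card V = n ∧ G.Connected ∧ G.edgeSet.ncard = n + 1 ∧
  ∃ (a b : V) (c1 : G.Walk a a) (c2 : G.Walk b b),
    c1.IsCycle ∧ c2.IsCycle ∧ c1.length = r ∧ c2.length = t ∧
    ({v | v ∈ c1.support} ∩ {v | v ∈ c2.support}).ncard = 1

/-- Vertex type for `S_n^{3,3}(m1,m2,n1,n2,m0)`: the five cycle vertices
(`0` = common vertex `u`, `1,2` = the other vertices of the first triangle,
`3,4` = the other vertices of the second triangle) together with the pendent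
vertices. -/
abbrev SVert (m1 m2 n1 n2 m0 : ℕ) : Type :=
  Fin 5 ⊕ Fin m1 ⊕ Fin m2 ⊕ Fin n1 ⊕ Fin n2 ⊕ Fin m0

/-- The graph `S_n^{3,3}(m1,m2,n1,n2,m0)`: two triangles sharing exactly the vertex `u`,
with `m1, m2` pendent vertices attached to the two non-common vertices of the first
triangle, `n1, n2` pendent vertices attached to those of the second triangle, and
`m0` pendent vertices attached to `u`.  `S_n^{3,3}(m1,n1,m0)` is `S33 m1 0 n1 0 m0`. -/
def S33 (m1 m2 n1 n2 m0 : ℕ) : SimpleGraph (SVert m1 m2 n1 n2 m0) :=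
  SimpleGraph.fromRel (fun x y =>
    (x = Sum.inl 0 ∧ y = Sum.inl 1) ∨
    (x = Sum.inl 1 ∧ y = Sum.inl 2) ∨
    (x = Sum.inl 2 ∧ y = Sum.inl 0) ∨
    (x = Sum.inl 0 ∧ y = Sum.inl 3) ∨
    (x = Sum.inl 3 ∧ y = Sum.inl 4) ∨
    (x = Sum.inl 4 ∧ y = Sum.inl 0) ∨
    (∃ i : Fin m1, x = Sum.inl 1 ∧ y = Sum.inr (Sum.inl i)) ∨
    (∃ i : Fin m2, x = Sum.inl 2 ∧ y = Sum.inr (Sum.inr (Sum.inl i))) ∨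
    (∃ i : Fin n1, x = Sum.inl 3 ∧ y = Sum.inr (Sum.inr (Sum.inr (Sum.inl i)))) ∨
    (∃ i : Fin n2, x = Sum.inl 4 ∧ y = Sum.inr (Sum.inr (Sum.inr (Sum.inr (Sum.inl i))))) ∨
    (∃ i : Fin m0, x = Sum.inl 0 ∧ y = Sum.inr (Sum.inr (Sum.inr (Sum.inr (Sum.inr i))))))

/-! ### Distance tables of edge lists -/

/-- `D` is the distance function of the graph on `{0, …, m - 1}` with edge list `E`,
in which every edge is listed once: each row vanishes on the diagonal, is `1`-Lipschitz along
edges, and descends along some edge at every other vertex. -/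
def IsDistTable (m : ℕ) (E : List (ℕ × ℕ)) (D : ℕ → ℕ → ℕ) : Prop :=
  E.Nodup ∧ (∀ p ∈ E, p.swap ∉ E) ∧ (∀ p ∈ E, p.1 < m ∧ p.2 < m) ∧
  (∀ i < m, D i i = 0) ∧
  (∀ i < m, ∀ p ∈ E, D i p.1 ≤ D i p.2 + 1 ∧ D i p.2 ≤ D i p.1 + 1) ∧
  ∀ i < m, ∀ j < m, j ≠ i →
    ∃ p ∈ E, (p.1 = j ∧ D i j = D i p.2 + 1) ∨ (p.2 = j ∧ D i j = D i p.1 + 1)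

set_option synthInstance.maxSize 2000 in
set_option synthInstance.maxHeartbeats 200000 in
instance (m : ℕ) (E : List (ℕ × ℕ)) (D : ℕ → ℕ → ℕ) : Decidable (IsDistTable m E D) := by
  unfold IsDistTable
  infer_instance

/-- The distance function after attaching a new leaf `m` to the vertex `p`. -/
def leafDist (D : ℕ → ℕ → ℕ) (m p i j : ℕ) : ℕ :=
  bif Nat.beq i m then bif Nat.beq j m then 0 else D p j + 1
  else bif Nat.beq j m then D i p + 1 else D i j

/-- The number of vertices below `m` that are closer to `a` than to `b`. -/
def closerCount (D : ℕ → ℕ → ℕ) (m a b : ℕ) : ℕ :=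
  Nat.count (fun w => D a w < D b w) m

/-- The update of `closerCount` along edges when a new leaf `m` is attached to `p`. -/
def leafCount (c D : ℕ → ℕ → ℕ) (m p a b : ℕ) : ℕ :=
  bif Nat.beq a m then 1 else bif Nat.beq b m then m
  else c a b + (bif Nat.blt (D a p) (D b p) then 1 else 0)

lemma leafDist_of_lt (D : ℕ → ℕ → ℕ) {m p i j : ℕ} (hi : i < m) (hj : j < m) :
    leafDist D m p i j = D i j := by
  simp [leafDist, hi.ne, hj.ne, cond_eq_ite]

lemma leafDist_right (D : ℕ → ℕ → ℕ) {m p i : ℕ} (hi : i < m) :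
    leafDist D m p i m = D i p + 1 := by
  simp [leafDist, hi.ne, cond_eq_ite]

lemma leafDist_left (D : ℕ → ℕ → ℕ) {m p j : ℕ} (hj : j < m) :
    leafDist D m p m j = D p j + 1 := by
  simp [leafDist, hj.ne, cond_eq_ite]

lemma leafDist_self (D : ℕ → ℕ → ℕ) (m p : ℕ) : leafDist D m p m m = 0 := by
  simp [leafDist]

lemma IsDistTable.attach_leaf {m p : ℕ} {E : List (ℕ × ℕ)} {D : ℕ → ℕ → ℕ}
    (h : IsDistTable m E D) (hp : p < m) :
    IsDistTable (m + 1) ((p, m) :: E) (leafDist D m p) := by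
  obtain ⟨hnd, hsw, hlt, hdiag, hlip, hdesc⟩ := h
  refine ⟨?_, ?_, ?_, ?_, ?_, ?_⟩
  · refine List.nodup_cons.2 ⟨fun hmem => ?_, hnd⟩
    exact absurd (hlt _ hmem).2 (lt_irrefl _)
  · intro e he hs
    rcases List.mem_cons.1 he with rfl | he
    · rcases List.mem_cons.1 hs with hs | hs
      · simp only [Prod.swap_prod_mk, Prod.mk.injEq] at hs
        omega
      · exact absurd (hlt _ hs).1 (lt_irrefl _)
    · rcases List.mem_cons.1 hs with hs | hs
      · have := (hlt _ he).1
        have h1 := congrArg Prod.snd hs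
        simp only [Prod.snd_swap] at h1
        omega
      · exact hsw e he hs
  · intro e he
    rcases List.mem_cons.1 he with rfl | he
    · exact ⟨by simp only; omega, by simp⟩
    · have := hlt e he
      omega
  · intro i hi
    rcases Nat.lt_succ_iff_lt_or_eq.1 hi with hi | rfl
    · rw [leafDist_of_lt D hi hi, hdiag i hi]
    · exact leafDist_self D _ p
  · intro i hi e he
    rcases Nat.lt_succ_iff_lt_or_eq.1 hi with hi | rfl <;> rcases List.mem_cons.1 he with rfl | he
    · simp only [leafDist_right D hi, leafDist_of_lt D hi hp]
      omega
    · have := hlt e he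
      rw [leafDist_of_lt D hi this.1, leafDist_of_lt D hi this.2]
      exact hlip i hi e he
    · simp only [leafDist_self, leafDist_left D hp, hdiag p hp]
      omega
    · have := hlt e he
      rw [leafDist_left D this.1, leafDist_left D this.2]
      have := hlip p hp e he
      omega
  · intro i hi j hj hne
    rcases Nat.lt_succ_iff_lt_or_eq.1 hi with hi | rfl <;>
      rcases Nat.lt_succ_iff_lt_or_eq.1 hj with hj | rfl
    · obtain ⟨e, he, h⟩ := hdesc i hi j hj hne
      refine ⟨e, List.mem_cons_of_mem _ he, ?_⟩
      rwa [leafDist_of_lt D hi hj, leafDist_of_lt D hi (hlt e he).1,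
        leafDist_of_lt D hi (hlt e he).2]
    · refine ⟨_, List.mem_cons_self, Or.inr ⟨rfl, ?_⟩⟩
      rw [leafDist_right D hi, leafDist_of_lt D hi hp]
    · by_cases hjp : j = p
      · subst hjp
        refine ⟨_, List.mem_cons_self, Or.inl ⟨rfl, ?_⟩⟩
        rw [leafDist_left D hj, leafDist_self, hdiag j hj]
      · obtain ⟨e, he, h⟩ := hdesc p hp j hj hjp
        refine ⟨e, List.mem_cons_of_mem _ he, ?_⟩
        rw [leafDist_left D hj, leafDist_left D (hlt e he).1, leafDist_left D (hlt e he).2]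
        omega
    · exact absurd rfl hne

lemma Nat.count_congr_of_lt {P Q : ℕ → Prop} [DecidablePred P] [DecidablePred Q] {m : ℕ}
    (h : ∀ w < m, P w ↔ Q w) : Nat.count P m = Nat.count Q m := by
  simp only [Nat.count_eq_card_filter_range]
  congr 1
  exact Finset.filter_congr fun w hw => h w (Finset.mem_range.1 hw)

lemma closerCount_leafDist_of_lt (D : ℕ → ℕ → ℕ) {m p a b : ℕ} (ha : a < m)
    (hb : b < m) :
    closerCount (leafDist D m p) (m + 1) a b = leafCount (closerCount D m) D m p a b := by
  have h : closerCount (leafDist D m p) m a b = closerCount D m a b :=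
    Nat.count_congr_of_lt fun w hw => by rw [leafDist_of_lt D ha hw, leafDist_of_lt D hb hw]
  unfold closerCount at h ⊢
  rw [Nat.count_succ, h, leafDist_right D ha, leafDist_right D hb]
  simp [leafCount, ha.ne, hb.ne, cond_eq_ite, Nat.blt_eq]

lemma closerCount_leafDist_right {D : ℕ → ℕ → ℕ} {m p : ℕ}
    (hp : p < m) : closerCount (leafDist D m p) (m + 1) p m = m := by
  have h : closerCount (leafDist D m p) m p m = Nat.count (fun _ => True) m :=
    Nat.count_congr_of_lt fun w hw => by
      rw [leafDist_of_lt D hp hw, leafDist_left D hw]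
      simp
  unfold closerCount at h ⊢
  rw [Nat.count_succ, h, leafDist_right D hp, leafDist_self]
  simp

lemma closerCount_leafDist_left {D : ℕ → ℕ → ℕ} {m p : ℕ}
    (hp : p < m) : closerCount (leafDist D m p) (m + 1) m p = 1 := by
  have h : closerCount (leafDist D m p) m m p = Nat.count (fun _ => False) m :=
    Nat.count_congr_of_lt fun w hw => by
      rw [leafDist_of_lt D hp hw, leafDist_left D hw]
      simp
  unfold closerCount at h ⊢
  rw [Nat.count_succ, h, leafDist_right D hp, leafDist_self]
  simp

/-- `c` agrees with `closerCount` on both orientations of every edge of `E`. -/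
def IsCountTable (m : ℕ) (E : List (ℕ × ℕ)) (D c : ℕ → ℕ → ℕ) : Prop :=
  ∀ e ∈ E, c e.1 e.2 = closerCount D m e.1 e.2 ∧ c e.2 e.1 = closerCount D m e.2 e.1

lemma IsCountTable.attach_leaf {m p : ℕ} {E : List (ℕ × ℕ)} {D c : ℕ → ℕ → ℕ}
    (h : IsCountTable m E D c) (hE : ∀ e ∈ E, e.1 < m ∧ e.2 < m) (hp : p < m) :
    IsCountTable (m + 1) ((p, m) :: E) (leafDist D m p) (leafCount c D m p) := by
  intro e he
  rcases List.mem_cons.1 he with rfl | he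
  · rw [closerCount_leafDist_right hp, closerCount_leafDist_left hp]
    simp [leafCount, hp.ne, cond_eq_ite]
  · obtain ⟨h1, h2⟩ := hE e he
    rw [closerCount_leafDist_of_lt D h1 h2, closerCount_leafDist_of_lt D h2 h1]
    simp only [leafCount, h e he, and_self]

/-! ### Graphs presented by edge lists -/

/-- The summand of the Graovac–Ghorbani index of an edge with side counts `x` and `y`. -/
noncomputable def ggWeight (x y : ℕ) : ℝ :=
  Real.sqrt (((x : ℝ) + (y : ℝ) - 2) / ((x : ℝ) * (y : ℝ)))

lemma ggWeight_comm (x y : ℕ) : ggWeight x y = ggWeight y x := by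
  unfold ggWeight
  rw [add_comm (x : ℝ), mul_comm (x : ℝ)]

/-- The connected graph `G` has the edge list `E` and the distance table `D`, under the
enumeration `φ` of its vertices by `{0, …, n - 1}`. -/
structure Presents {V : Type*} [Fintype V] (G : SimpleGraph V) (n : ℕ) (φ : ℕ → V)
    (E : List (ℕ × ℕ)) (D : ℕ → ℕ → ℕ) : Prop where
  connected : G.Connected
  card : Fintype.card V = n
  ncard_edgeSet : G.edgeSet.ncard = E.length
  table : IsDistTable n E D
  injOn : ∀ i < n, ∀ j < n, φ i = φ j → i = j
  adj : ∀ e ∈ E, G.Adj (φ e.1) (φ e.2)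

namespace Presents

variable {V : Type*} [Fintype V] {G : SimpleGraph V} {n : ℕ} {φ : ℕ → V} {E : List (ℕ × ℕ)}
  {D : ℕ → ℕ → ℕ}

lemma exists_eq (h : Presents G n φ E D) (v : V) : ∃ i < n, φ i = v := by
  have hinj : Function.Injective fun i : Fin n => φ i := fun i j hij =>
    Fin.ext (h.injOn i i.2 j j.2 hij)
  have hbij := (Fintype.bijective_iff_injective_and_card _).2 ⟨hinj, by simp [h.card]⟩
  obtain ⟨i, hi⟩ := hbij.2 v
  exact ⟨i, i.2, hi⟩

lemma nodup_darts (h : Presents G n φ E D) :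
    ((E ++ E.map Prod.swap).map (Prod.map φ φ)).Nodup := by
  obtain ⟨hnd, hsw, hlt, -⟩ := h.table
  have hlt' : ∀ e ∈ E ++ E.map Prod.swap, e.1 < n ∧ e.2 < n := by
    intro e he
    rcases List.mem_append.1 he with he | he
    · exact hlt e he
    · obtain ⟨e, he', rfl⟩ := List.mem_map.1 he
      exact (hlt e he').symm
  refine List.Nodup.map_on ?_ ?_
  · intro x hx y hy hxy
    obtain ⟨h1, h2⟩ := Prod.mk.inj hxy
    exact Prod.ext (h.injOn _ (hlt' x hx).1 _ (hlt' y hy).1 h1)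
      (h.injOn _ (hlt' x hx).2 _ (hlt' y hy).2 h2)
  · refine List.Nodup.append hnd (hnd.map Prod.swap_injective) ?_
    intro x hx hx'
    obtain ⟨e, he, rfl⟩ := List.mem_map.1 hx'
    exact hsw e he hx

open Classical in
lemma filter_adj_eq (h : Presents G n φ E D) :
    (Finset.univ.filter fun p : V × V => G.Adj p.1 p.2) =
      ((E ++ E.map Prod.swap).map (Prod.map φ φ)).toFinset := by
  symm
  refine Finset.eq_of_subset_of_card_le ?_ ?_
  · intro p hp
    obtain ⟨e, he, rfl⟩ := List.mem_map.1 (List.mem_toFinset.1 hp)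
    rcases List.mem_append.1 he with he | he
    · simpa using h.adj e he
    · obtain ⟨e, he', rfl⟩ := List.mem_map.1 he
      simpa using (h.adj e he').symm
  · have hcard : (Finset.univ.filter fun p : V × V => G.Adj p.1 p.2).card = 2 * E.length := by
      rw [← h.ncard_edgeSet, ← SimpleGraph.coe_edgeFinset, Set.ncard_coe_finset,
        ← G.sum_degrees_eq_twice_card_edges, Finset.card_filter, Fintype.sum_prod_type]
      refine Finset.sum_congr rfl fun v _ => ?_
      rw [← Finset.card_filter, ← SimpleGraph.card_neighborFinset_eq_degree,
        SimpleGraph.neighborFinset_eq_filter]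
    rw [hcard, List.toFinset_card_of_nodup h.nodup_darts]
    simp [two_mul]

lemma adj_iff (h : Presents G n φ E D) {i j : ℕ} (hi : i < n) (hj : j < n) :
    G.Adj (φ i) (φ j) ↔ (i, j) ∈ E ∨ (j, i) ∈ E := by
  classical
  constructor
  · intro hadj
    have hmem : (φ i, φ j) ∈ Finset.univ.filter fun p : V × V => G.Adj p.1 p.2 := by simpa
    rw [h.filter_adj_eq] at hmem
    obtain ⟨e, he, heq⟩ := List.mem_map.1 (List.mem_toFinset.1 hmem)
    obtain ⟨h1, h2⟩ := Prod.mk.inj heq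
    have hlt := h.table.2.2.1
    rcases List.mem_append.1 he with he | he
    · have e1 := h.injOn _ (hlt e he).1 _ hi h1
      have e2 := h.injOn _ (hlt e he).2 _ hj h2
      subst e1 e2
      exact Or.inl he
    · obtain ⟨e, he', rfl⟩ := List.mem_map.1 he
      have e1 := h.injOn _ (hlt e he').2 _ hi h1
      have e2 := h.injOn _ (hlt e he').1 _ hj h2
      subst e1 e2
      exact Or.inr he'
  · rintro (he | he)
    · exact h.adj _ he
    · exact (h.adj _ he).symm

lemma dist_le (h : Presents G n φ E D) {i : ℕ} (hi : i < n) :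
    ∀ d, ∀ j < n, D i j = d → G.dist (φ i) (φ j) ≤ d := by
  obtain ⟨-, -, hlt, -, -, hdesc⟩ := h.table
  have step : ∀ {j k : ℕ}, G.Adj (φ k) (φ j) →
      G.dist (φ i) (φ j) ≤ G.dist (φ i) (φ k) + 1 := fun hadj =>
    h.connected.dist_triangle.trans (by rw [SimpleGraph.dist_eq_one_iff_adj.2 hadj])
  intro d
  induction d with
  | zero =>
    intro j hj hd
    by_cases hji : j = i
    · simp [hji]
    · obtain ⟨e, -, he⟩ := hdesc i hi j hj hji
      omega
  | succ d ih =>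
    intro j hj hd
    by_cases hji : j = i
    · simp [hji]
    · obtain ⟨e, he, ⟨rfl, h'⟩ | ⟨rfl, h'⟩⟩ := hdesc i hi j hj hji
      · have := ih e.2 (hlt e he).2 (by omega)
        have := step (h.adj e he).symm
        omega
      · have := ih e.1 (hlt e he).1 (by omega)
        have := step (h.adj e he)
        omega

lemma le_add_length (h : Presents G n φ E D) {i : ℕ} (hi : i < n) {u v : V} (w : G.Walk u v) :
    ∀ j < n, ∀ k < n, φ j = u → φ k = v → D i k ≤ D i j + w.length := by
  induction w with
  | nil =>
    intro j hj k hk hu hv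
    rw [h.injOn j hj k hk (hu.trans hv.symm)]
    simp
  | cons hadj w ih =>
    rename_i a b c
    intro j hj k hk hu hv
    obtain ⟨l, hl, rfl⟩ := h.exists_eq b
    subst hu
    have h1 := ih l hl k hk rfl hv
    have h2 : D i l ≤ D i j + 1 := by
      rcases (h.adj_iff hj hl).1 hadj with he | he
      · exact (h.table.2.2.2.2.1 i hi _ he).2
      · exact (h.table.2.2.2.2.1 i hi _ he).1
    rw [SimpleGraph.Walk.length_cons]
    omega

lemma dist_eq (h : Presents G n φ E D) {i j : ℕ} (hi : i < n) (hj : j < n) :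
    G.dist (φ i) (φ j) = D i j := by
  refine le_antisymm (h.dist_le hi _ j hj rfl) ?_
  obtain ⟨w, hw⟩ := h.connected.exists_walk_length_eq_dist (φ i) (φ j)
  have := h.le_add_length hi w i hi j hj rfl rfl
  rw [h.table.2.2.2.1 i hi] at this
  omega

lemma sideCount_eq (h : Presents G n φ E D) {a b : ℕ} (ha : a < n) (hb : b < n) :
    sideCount G (φ a) (φ b) = closerCount D n a b := by
  classical
  rw [sideCount, Nat.card_eq_fintype_card, Fintype.card_subtype, closerCount,
    Nat.count_eq_card_filter_range]
  symm
  have key : ∀ i < n, (G.dist (φ i) (φ a) < G.dist (φ i) (φ b) ↔ D a i < D b i) := by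
    intro i hi
    rw [G.dist_comm, h.dist_eq ha hi, G.dist_comm, h.dist_eq hb hi]
  refine Finset.card_bij (fun i _ => φ i) ?_ ?_ ?_
  · intro i hi
    simp only [Finset.mem_filter, Finset.mem_range, Finset.mem_univ, true_and] at hi ⊢
    exact (key i hi.1).2 hi.2
  · intro i hi j hj hij
    simp only [Finset.mem_filter, Finset.mem_range] at hi hj
    exact h.injOn i hi.1 j hj.1 hij
  · intro v hv
    obtain ⟨i, hi, rfl⟩ := h.exists_eq v
    simp only [Finset.mem_filter, Finset.mem_univ, true_and] at hv
    exact ⟨i, by simpa [hi] using (key i hi).1 hv, rfl⟩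

lemma ABCGG_eq (h : Presents G n φ E D) :
    ABCGG G =
      (E.map fun e => ggWeight (closerCount D n e.1 e.2) (closerCount D n e.2 e.1)).sum := by
  classical
  have hlt := h.table.2.2.1
  have hleft : ∀ e ∈ E, ggWeight (sideCount G (φ e.1) (φ e.2)) (sideCount G (φ e.2) (φ e.1)) =
      ggWeight (closerCount D n e.1 e.2) (closerCount D n e.2 e.1) := fun e he => by
    rw [h.sideCount_eq (hlt e he).1 (hlt e he).2, h.sideCount_eq (hlt e he).2 (hlt e he).1]
  have hright : ∀ e ∈ E, ggWeight (sideCount G (φ e.2) (φ e.1)) (sideCount G (φ e.1) (φ e.2)) =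
      ggWeight (closerCount D n e.1 e.2) (closerCount D n e.2 e.1) := fun e he => by
    rw [ggWeight_comm, hleft e he]
  have hsum : ABCGG G = (1 / 2) * ∑ p ∈ Finset.univ.filter fun p : V × V => G.Adj p.1 p.2,
      ggWeight (sideCount G p.1 p.2) (sideCount G p.2 p.1) := by
    rw [ABCGG, Finset.sum_filter, Fintype.sum_prod_type]
    rfl
  rw [hsum, h.filter_adj_eq, List.sum_toFinset _ h.nodup_darts, List.map_append, List.map_append,
    List.sum_append, List.map_map, List.map_map, List.map_map, ← List.map_congr_left hleft]
  have hswap := (List.map_congr_left hright).trans (List.map_congr_left hleft).symm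
  have hsum' := congrArg List.sum hswap
  simp only [Function.comp_def, Prod.map_fst, Prod.map_snd, Prod.fst_swap, Prod.snd_swap]
  linarith

end Presents

/-! ### The extremal graph -/

/-- The adjacency test of the edge list `E`. -/
def adjTest (E : List (ℕ × ℕ)) (i j : ℕ) : Bool := E.contains (i, j) || E.contains (j, i)

/-- Distances in a cycle of length `r`. -/
def cycleDist (r i j : ℕ) : ℕ := min (i - j + (j - i)) (r - (i - j + (j - i)))

/-- Distances in the union of two cycles of lengths `r` and `t` that share the vertex `0`, the
other vertices being `1, …, r - 1` on the first cycle and `r, …, r + t - 2` on the second. -/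
def coreDist (r t i j : ℕ) : ℕ :=
  bif Nat.blt i r then
    bif Nat.blt j r then cycleDist r i j else cycleDist r i 0 + cycleDist t 0 (j - r + 1)
  else
    bif Nat.blt j r then cycleDist t (i - r + 1) 0 + cycleDist r 0 j
    else cycleDist t (i - r + 1) (j - r + 1)

/-- The edges of the union of two cycles of lengths `r` and `t` that share the vertex `0`. -/
def coreEdges (r t : ℕ) : List (ℕ × ℕ) :=
  (List.range (r - 1)).map (fun i => (i, i + 1)) ++ [(r - 1, 0), (0, r)] ++
    (List.range (t - 2)).map (fun i => (r + i, r + i + 1)) ++ [(r + t - 2, 0)]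

/-- The edges of `S33 2 0 2 0 0`. -/
def extremalEdges : List (ℕ × ℕ) := [(3, 8), (3, 7), (1, 6), (1, 5)] ++ coreEdges 3 3

/-- The distances of `S33 2 0 2 0 0`. -/
def extremalDist : ℕ → ℕ → ℕ :=
  leafDist (leafDist (leafDist (leafDist (coreDist 3 3) 5 1) 6 1) 7 3) 8 3

/-- The vertices of `S33 2 0 2 0 0`, in the order used by `extremalEdges`. -/
def extremalVertex (i : ℕ) : SVert 2 0 2 0 0 :=
  [.inl 0, .inl 1, .inl 2, .inl 3, .inl 4, .inr (.inl 0), .inr (.inl 1),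
    .inr (.inr (.inr (.inl 0))), .inr (.inr (.inr (.inl 1)))].getD i (.inl 0)

/-- The inverse of `extremalVertex`. -/
def extremalIndex : SVert 2 0 2 0 0 → ℕ
  | .inl i => i
  | .inr (.inl i) => 5 + i
  | .inr (.inr (.inr (.inl i))) => 7 + i
  | _ => 0

set_option synthInstance.maxSize 2000 in
set_option synthInstance.maxHeartbeats 200000 in
instance : DecidableRel (S33 2 0 2 0 0).Adj := fun x y =>
  decidable_of_iff _ (SimpleGraph.fromRel_adj _ x y).symm

lemma S33_adj_iff (x y : SVert 2 0 2 0 0) :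
    (S33 2 0 2 0 0).Adj x y ↔ adjTest extremalEdges (extremalIndex x) (extremalIndex y) = true := by
  revert x y
  decide +kernel

lemma extremalIndex_injective : Function.Injective extremalIndex := by decide +kernel

lemma extremalIndex_lt (x : SVert 2 0 2 0 0) : extremalIndex x < 9 := by
  revert x
  decide +kernel

/-- The value of the Graovac–Ghorbani index at the extremal graph. -/
noncomputable def extremalValue : ℝ :=
  2 * Real.sqrt (2 / 3) + 2 * Real.sqrt (6 / 15) + 2 * Real.sqrt (4 / 5) + 4 * Real.sqrt (7 / 8)

set_option synthInstance.maxSize 2000 in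
set_option synthInstance.maxHeartbeats 200000 in
lemma ABCGG_eq_extremalValue {V : Type*} [Fintype V] {G : SimpleGraph V} (hconn : G.Connected)
    (hcard : Fintype.card V = 9) (hedges : G.edgeSet.ncard = 10) (e : G ≃g S33 2 0 2 0 0) :
    ABCGG G = extremalValue := by
  have hP : Presents G 9 (fun i => e.symm (extremalVertex i)) extremalEdges extremalDist := by
    refine ⟨hconn, hcard, hedges, by decide +kernel, ?_, ?_⟩
    · intro i hi j hj hij
      have hinj : ∀ i < 9, ∀ j < 9, extremalVertex i = extremalVertex j → i = j := by
        decide +kernel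
      exact hinj i hi j hj (e.symm.injective hij)
    · intro p hp
      have hadj : ∀ p ∈ extremalEdges,
          (S33 2 0 2 0 0).Adj (extremalVertex p.1) (extremalVertex p.2) := by decide +kernel
      exact e.symm.map_rel_iff.2 (hadj p hp)
  have hcounts : (extremalEdges.map fun p =>
      (closerCount extremalDist 9 p.1 p.2, closerCount extremalDist 9 p.2 p.1)) =
      [(8, 1), (8, 1), (8, 1), (8, 1), (5, 3), (3, 1), (1, 5), (5, 3), (3, 1), (1, 5)] := by
    decide +kernel
  have hsum := congrArg (fun l => (l.map fun q : ℕ × ℕ => ggWeight q.1 q.2).sum) hcounts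
  simp only [List.map_map, Function.comp_def] at hsum
  rw [hP.ABCGG_eq, hsum, extremalValue]
  norm_num [ggWeight]
  ring

lemma lt_extremalValue : (8.42 : ℝ) < extremalValue := by
  have h1 : (0.816 : ℝ) ≤ Real.sqrt (2 / 3) := Real.le_sqrt_of_sq_le (by norm_num)
  have h2 : (0.632 : ℝ) ≤ Real.sqrt (6 / 15) := Real.le_sqrt_of_sq_le (by norm_num)
  have h3 : (0.894 : ℝ) ≤ Real.sqrt (4 / 5) := Real.le_sqrt_of_sq_le (by norm_num)
  have h4 : (0.935 : ℝ) ≤ Real.sqrt (7 / 8) := Real.le_sqrt_of_sq_le (by norm_num)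
  unfold extremalValue
  linarith

/-! ### Exhausting the graphs obtained by attaching leaves -/

/-- `10 ^ 4 * ggWeight x y`, rounded up, for `1 ≤ x, y ≤ 9`. -/
def weightBound (x y : ℕ) : ℕ :=
  (([[],
    [0, 0, 7072, 8165, 8661, 8945, 9129, 9259, 9355, 9429],
    [0, 7072, 7072, 7072, 7072, 7072, 7072, 7072, 7072, 7072],
    [0, 8165, 7072, 6667, 6455, 6325, 6237, 6173, 6124, 6086],
    [0, 8661, 7072, 6455, 6124, 5917, 5774, 5670, 5591, 5528],
    [0, 8945, 7072, 6325, 5917, 5657, 5478, 5346, 5245, 5164],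
    [0, 9129, 7072, 6237, 5774, 5478, 5271, 5118, 5000, 4907],
    [0, 9259, 7072, 6173, 5670, 5346, 5118, 4949, 4819, 4715],
    [0, 9355, 7072, 6124, 5591, 5245, 5000, 4819, 4678, 4565],
    [0, 9429, 7072, 6086, 5528, 5164, 4907, 4715, 4565, 4445]] : List (List ℕ)).getD x []).getD y 0

lemma ggWeight_le_weightBound {x y : ℕ} (hx : x < 10) (hy : y < 10) :
    ggWeight x y ≤ (weightBound x y : ℝ) / 10 ^ 4 := by
  have key : ∀ x < 10, ∀ y < 10,
      x * y = 0 ∨ (x + y) * 10 ^ 8 ≤ weightBound x y ^ 2 * (x * y) + 2 * 10 ^ 8 := by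
    decide +kernel
  refine Real.sqrt_le_iff.2 ⟨by positivity, ?_⟩
  rcases key x hx y hy with h | h
  · have h' : (x : ℝ) * y = 0 := by exact_mod_cast h
    rw [h', div_zero]
    positivity
  · rcases Nat.eq_zero_or_pos (x * y) with h0 | h0
    · have h' : (x : ℝ) * y = 0 := by exact_mod_cast h0
      rw [h', div_zero]
      positivity
    · have h0' : (0 : ℝ) < (x : ℝ) * y := by exact_mod_cast h0
      have h' : ((x : ℝ) + y) * 10 ^ 8 ≤ (weightBound x y : ℝ) ^ 2 * (x * y) + 2 * 10 ^ 8 := by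
        exact_mod_cast h
      rw [div_le_iff₀ h0', div_pow]
      linarith

/-- An upper bound of `10 ^ 4` times the Graovac–Ghorbani index. -/
def scoreBound (E : List (ℕ × ℕ)) (c : ℕ → ℕ → ℕ) : ℕ :=
  (E.map fun e => weightBound (c e.1 e.2) (c e.2 e.1)).sum

/-- The symmetries of the two triangles that fix or flip each of them. -/
def triangleFlips : List (List ℕ) :=
  [[0, 1, 2, 3, 4, 5, 6, 7, 8], [0, 2, 1, 3, 4, 5, 6, 7, 8], [0, 1, 2, 4, 3, 5, 6, 7, 8],
    [0, 2, 1, 4, 3, 5, 6, 7, 8]]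

/-- Tests whether a relabelling in `triangleFlips` turns `E` into `extremalEdges`. -/
def isExtremal (E : List (ℕ × ℕ)) : Bool :=
  triangleFlips.any fun τ => (List.range 9).all fun i => (List.range 9).all fun j =>
    adjTest extremalEdges i j == adjTest E (τ.getD i 0) (τ.getD j 0)

/-- Attaches `k` leaves `m, m + 1, …` successively in all ways in which the attaching vertices
are at least `q` and nondecreasing, and tests each resulting graph for being extremal or having
an index below that of the extremal graph. -/
def leafSearch : ℕ → ℕ → ℕ → List (ℕ × ℕ) → (ℕ → ℕ → ℕ) → (ℕ → ℕ → ℕ) → Bool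
  | 0, _, _, E, _, c => Nat.blt (scoreBound E c) 84200 || isExtremal E
  | k + 1, m, q, E, D, c => (List.range m).all fun p =>
      Nat.blt p q || leafSearch k (m + 1) p ((p, m) :: E) (leafDist D m p) (leafCount c D m p)

lemma Presents.nonempty_iso {V : Type*} [Fintype V] {G : SimpleGraph V} {φ : ℕ → V}
    {E : List (ℕ × ℕ)} {D : ℕ → ℕ → ℕ} (h : Presents G 9 φ E D) (hE : isExtremal E = true) :
    Nonempty (G ≃g S33 2 0 2 0 0) := by
  obtain ⟨τ, hτ, hadj⟩ := List.any_eq_true.1 hE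
  simp only [List.all_eq_true, List.mem_range, beq_iff_eq] at hadj
  have hτ' : ∀ τ ∈ triangleFlips, (∀ i < 9, τ.getD i 0 < 9) ∧
      ∀ i < 9, ∀ j < 9, τ.getD i 0 = τ.getD j 0 → i = j := by decide +kernel
  obtain ⟨hlt, hinj⟩ := hτ' τ hτ
  have hbij : Function.Bijective fun x => φ (τ.getD (extremalIndex x) 0) := by
    refine (Fintype.bijective_iff_injective_and_card _).2 ⟨fun x y hxy => ?_, ?_⟩
    · have hx := extremalIndex_lt x
      have hy := extremalIndex_lt y
      exact extremalIndex_injective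
        (hinj _ hx _ hy (h.injOn _ (hlt _ hx) _ (hlt _ hy) hxy))
    · rw [h.card]
      simp
  refine ⟨SimpleGraph.Iso.symm ⟨Equiv.ofBijective _ hbij, ?_⟩⟩
  intro x y
  have hx := extremalIndex_lt x
  have hy := extremalIndex_lt y
  rw [S33_adj_iff, hadj _ hx _ hy]
  simp only [Equiv.ofBijective_apply]
  rw [h.adj_iff (hlt _ hx) (hlt _ hy)]
  simp [adjTest]

lemma Presents.ABCGG_lt {V : Type*} [Fintype V] {G : SimpleGraph V} {φ : ℕ → V}
    {E : List (ℕ × ℕ)} {D c : ℕ → ℕ → ℕ} (h : Presents G 9 φ E D) (hc : IsCountTable 9 E D c)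
    (hs : scoreBound E c < 84200) : ABCGG G < extremalValue := by
  have hle : (E.map fun e => ggWeight (closerCount D 9 e.1 e.2) (closerCount D 9 e.2 e.1)).sum ≤
      (E.map fun e => (weightBound (c e.1 e.2) (c e.2 e.1) : ℝ) / 10 ^ 4).sum := by
    refine List.sum_le_sum fun e he => ?_
    rw [(hc e he).1, (hc e he).2]
    exact ggWeight_le_weightBound (Nat.lt_succ_of_le (Nat.count_le _))
      (Nat.lt_succ_of_le (Nat.count_le _))
  have heq : (E.map fun e => (weightBound (c e.1 e.2) (c e.2 e.1) : ℝ) / 10 ^ 4).sum =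
      (scoreBound E c : ℝ) / 10 ^ 4 := by
    rw [scoreBound, Nat.cast_list_sum, List.map_map]
    simp only [div_eq_mul_inv, List.sum_map_mul_right, Function.comp_def]
  have hs' : (scoreBound E c : ℝ) < 84200 := by exact_mod_cast hs
  rw [h.ABCGG_eq]
  have := lt_extremalValue
  linarith

/-- A proper initial segment of the vertices of a connected graph of order `n` has a first vertex
with a neighbour outside of it. -/
lemma SimpleGraph.Connected.exists_first_boundary_adj {V : Type*} [Fintype V] {G : SimpleGraph V}
    (hconn : G.Connected) {m : ℕ} {φ : ℕ → V} (hm : 0 < m) (hcard : m < Fintype.card V) :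
    ∃ p < m, (∃ x, G.Adj (φ p) x ∧ ∀ i < m, φ i ≠ x) ∧
      ∀ j < p, ∀ x, G.Adj (φ j) x → ∃ i < m, φ i = x := by
  classical
  obtain ⟨v, hv⟩ : ∃ v, v ∉ (Finset.range m).image φ := by
    by_contra! hall
    have h1 : Finset.univ ⊆ (Finset.range m).image φ := fun v _ => hall v
    have := (Finset.card_le_card h1).trans Finset.card_image_le
    rw [Finset.card_univ, Finset.card_range] at this
    omega
  obtain ⟨w⟩ := hconn (φ 0) v
  obtain ⟨d, -, hd1, hd2⟩ := w.exists_boundary_dart ((Finset.range m).image φ)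
    (Finset.mem_coe.2 (Finset.mem_image_of_mem φ (Finset.mem_range.2 hm))) (by simpa using hv)
  obtain ⟨k, hk, hkd⟩ := Finset.mem_image.1 (Finset.mem_coe.1 hd1)
  have hex : ∃ p, p < m ∧ ∃ x, G.Adj (φ p) x ∧ ∀ i < m, φ i ≠ x := by
    refine ⟨k, Finset.mem_range.1 hk, d.snd, hkd ▸ d.adj, fun i hi hid => hd2 ?_⟩
    exact Finset.mem_coe.2 (Finset.mem_image.2 ⟨i, Finset.mem_range.2 hi, hid⟩)
  refine ⟨Nat.find hex, (Nat.find_spec hex).1, (Nat.find_spec hex).2, fun j hj x hx => ?_⟩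
  by_contra! hno
  exact Nat.find_min hex hj ⟨hj.trans (Nat.find_spec hex).1, x, hx, hno⟩

lemma lt_or_nonempty_iso_of_leafSearch {V : Type*} [Fintype V] {G : SimpleGraph V}
    (hconn : G.Connected) (hcard : Fintype.card V = 9) (hedges : G.edgeSet.ncard = 10) :
    ∀ (k m q : ℕ) (E : List (ℕ × ℕ)) (D c : ℕ → ℕ → ℕ) (φ : ℕ → V), m + k = 9 → 0 < m →
      IsDistTable m E D → IsCountTable m E D c → E.length = m + 1 →
      (∀ i < m, ∀ j < m, φ i = φ j → i = j) → (∀ e ∈ E, G.Adj (φ e.1) (φ e.2)) →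
      (∀ j < q, ∀ x, G.Adj (φ j) x → ∃ i < m, φ i = x) →
      leafSearch k m q E D c = true →
      ABCGG G < extremalValue ∨ Nonempty (G ≃g S33 2 0 2 0 0) := by
  intro k
  induction k with
  | zero =>
    intro m q E D c φ hm _ hD hc hE hinj hadj _ hs
    obtain rfl : m = 9 := hm
    have hP : Presents G 9 φ E D := ⟨hconn, hcard, by rw [hedges, hE], hD, hinj, hadj⟩
    rcases Bool.or_eq_true _ _ ▸ hs with hs | hs
    · exact Or.inl (hP.ABCGG_lt hc (by simpa using hs))
    · exact Or.inr (hP.nonempty_iso hs)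
  | succ k ih =>
    intro m q E D c φ hm hm0 hD hc hE hinj hadj hq hs
    have hlt := hD.2.2.1
    obtain ⟨p, hp, ⟨x, hpx, hx⟩, hmin⟩ :=
      hconn.exists_first_boundary_adj (φ := φ) hm0 (by omega : m < Fintype.card V)
    have hpq : ¬ p < q := fun hpq => by
      obtain ⟨i, hi, hix⟩ := hq p hpq x hpx
      exact hx i hi hix
    have hs' := List.all_eq_true.1 hs p (List.mem_range.2 hp)
    rw [Bool.or_eq_true, Nat.blt_eq] at hs'
    have hφ : ∀ i < m, Function.update φ m x i = φ i := fun i hi =>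
      Function.update_of_ne hi.ne _ _
    have hφm : Function.update φ m x m = x := Function.update_self _ _ _
    refine ih (m + 1) p _ _ _ (Function.update φ m x) (by omega) (by omega)
      (hD.attach_leaf hp) (hc.attach_leaf hlt hp) (by simp [hE]) ?_ ?_ ?_ (hs'.resolve_left hpq)
    · intro i hi j hj hij
      rcases Nat.lt_succ_iff_lt_or_eq.1 hi with hi | rfl <;>
        rcases Nat.lt_succ_iff_lt_or_eq.1 hj with hj | rfl
      · rw [hφ i hi, hφ j hj] at hij
        exact hinj i hi j hj hij
      · rw [hφ i hi, hφm] at hij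
        exact absurd hij (hx i hi)
      · rw [hφ j hj, hφm] at hij
        exact absurd hij.symm (hx j hj)
      · rfl
    · intro e he
      rcases List.mem_cons.1 he with rfl | he
      · simpa only [hφ p hp, hφm] using hpx
      · rw [hφ _ (hlt e he).1, hφ _ (hlt e he).2]
        exact hadj e he
    · intro j hj y hy
      rw [hφ j (hj.trans hp)] at hy
      obtain ⟨i, hi, rfl⟩ := hmin j hj y hy
      exact ⟨i, by omega, hφ i hi⟩

/-! ### The two cycles -/

set_option synthInstance.maxSize 2000 in
set_option synthInstance.maxHeartbeats 200000 in
lemma core_check : ∀ r < 8, ∀ t < 8, 3 ≤ r → r ≤ t → r + t ≤ 10 →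
    IsDistTable (r + t - 1) (coreEdges r t) (coreDist r t) ∧
    leafSearch (10 - r - t) (r + t - 1) 0 (coreEdges r t) (coreDist r t)
      (closerCount (coreDist r t) (r + t - 1)) = true := by
  decide +kernel

/-- The vertices of two closed walks through a common vertex, in the order used by
`coreEdges`. -/
def coreVertex {V : Type*} {G : SimpleGraph V} {u : V} (c₁ c₂ : G.Walk u u) (i : ℕ) : V :=
  if i < c₁.length then c₁.getVert i else c₂.getVert (i - c₁.length + 1)

section Core

variable {V : Type*} {G : SimpleGraph V} {u : V} {c₁ c₂ : G.Walk u u}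

lemma coreVertex_injOn (h₁ : c₁.IsCycle) (h₂ : c₂.IsCycle)
    (hc : ∀ v ∈ c₁.support, v ∈ c₂.support → v = u) :
    ∀ i < c₁.length + c₂.length - 1, ∀ j < c₁.length + c₂.length - 1,
      coreVertex c₁ c₂ i = coreVertex c₁ c₂ j → i = j := by
  have l₁ := h₁.three_le_length
  have l₂ := h₂.three_le_length
  have inj₁ : ∀ i < c₁.length, ∀ j < c₁.length, c₁.getVert i = c₁.getVert j → i = j :=
    fun i hi j hj hij => h₁.getVert_injOn' (by simp only [Set.mem_ofPred_eq]; omega)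
      (by simp only [Set.mem_ofPred_eq]; omega) hij
  have inj₂ : ∀ i < c₂.length, ∀ j < c₂.length, c₂.getVert i = c₂.getVert j → i = j :=
    fun i hi j hj hij => h₂.getVert_injOn' (by simp only [Set.mem_ofPred_eq]; omega)
      (by simp only [Set.mem_ofPred_eq]; omega) hij
  have cross : ∀ i j, j + 1 < c₂.length → c₁.getVert i ≠ c₂.getVert (j + 1) := by
    intro i j hj hij
    have hu := hc _ (c₁.getVert_mem_support i) (hij ▸ c₂.getVert_mem_support (j + 1))
    have := inj₂ (j + 1) hj 0 (by omega) (by rw [← hij, hu, c₂.getVert_zero])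
    omega
  intro i hi j hj hij
  unfold coreVertex at hij
  split_ifs at hij with hi' hj' hj'
  · exact inj₁ i hi' j hj' hij
  · exact absurd hij (cross _ _ (by omega))
  · exact absurd hij.symm (cross _ _ (by omega))
  · have := inj₂ _ (by omega) _ (by omega) hij
    omega

lemma adj_coreVertex (h₁ : c₁.IsCycle) (h₂ : c₂.IsCycle) :
    ∀ e ∈ coreEdges c₁.length c₂.length, G.Adj (coreVertex c₁ c₂ e.1) (coreVertex c₁ c₂ e.2) := by
  have l₁ := h₁.three_le_length
  have l₂ := h₂.three_le_length
  have left : ∀ i < c₁.length, coreVertex c₁ c₂ i = c₁.getVert i := fun i hi => if_pos hi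
  have right : ∀ i, coreVertex c₁ c₂ (c₁.length + i) = c₂.getVert (i + 1) := fun i => by
    rw [coreVertex, if_neg (by omega), Nat.add_sub_cancel_left]
  have zero : coreVertex c₁ c₂ 0 = u := by rw [left 0 (by omega), c₁.getVert_zero]
  intro e he
  simp only [coreEdges, List.mem_append, List.mem_map, List.mem_range, List.mem_cons,
    List.not_mem_nil, or_false] at he
  rcases he with ((⟨i, hi, rfl⟩ | rfl | rfl) | ⟨i, hi, rfl⟩) | rfl
  · rw [left _ (by omega), left _ (by omega)]
    exact c₁.adj_getVert_succ (by omega)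
  · have := c₁.adj_getVert_succ (i := c₁.length - 1) (by omega)
    rw [Nat.sub_add_cancel (by omega), c₁.getVert_length] at this
    rwa [zero, left _ (by omega)]
  · have := c₂.adj_getVert_succ (i := 0) (by omega)
    rw [c₂.getVert_zero] at this
    simpa only [zero, ← right 0, add_zero] using this
  · have := c₂.adj_getVert_succ (i := i + 1) (by omega)
    rwa [right, add_assoc, right]
  · have := c₂.adj_getVert_succ (i := c₂.length - 1) (by omega)
    rw [Nat.sub_add_cancel (by omega), c₂.getVert_length] at this
    rw [zero, show c₁.length + c₂.length - 2 = c₁.length + (c₂.length - 2) by omega, right,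
      show c₂.length - 2 + 1 = c₂.length - 1 by omega]
    exact this

end Core

lemma length_coreEdges {r t : ℕ} (hr : 3 ≤ r) (ht : 3 ≤ t) :
    (coreEdges r t).length = r + t - 1 + 1 := by
  simp [coreEdges]
  omega

lemma lt_or_nonempty_iso_of_cycles {V : Type*} [Fintype V] {G : SimpleGraph V} {u : V}
    {c₁ c₂ : G.Walk u u} (hconn : G.Connected) (hcard : Fintype.card V = 9)
    (hedges : G.edgeSet.ncard = 10) (h₁ : c₁.IsCycle) (h₂ : c₂.IsCycle)
    (hc : ∀ v ∈ c₁.support, v ∈ c₂.support → v = u) (hle : c₁.length ≤ c₂.length) :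
    ABCGG G < extremalValue ∨ Nonempty (G ≃g S33 2 0 2 0 0) := by
  have l₁ := h₁.three_le_length
  have l₂ := h₂.three_le_length
  have hinj := coreVertex_injOn h₁ h₂ hc
  have hbound : c₁.length + c₂.length - 1 ≤ 9 := by
    rw [← hcard, ← Fintype.card_fin (c₁.length + c₂.length - 1)]
    exact Fintype.card_le_of_injective (fun i => coreVertex c₁ c₂ i)
      fun i j hij => Fin.ext (hinj i i.2 j j.2 hij)
  obtain ⟨hD, hs⟩ := core_check _ (by omega) _ (by omega) l₁ hle (by omega)
  exact lt_or_nonempty_iso_of_leafSearch hconn hcard hedges _ _ _ _ _ _ (coreVertex c₁ c₂)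
    (by omega) (by omega) hD (fun _ _ => ⟨rfl, rfl⟩) (length_coreEdges l₁ l₂) hinj
    (adj_coreVertex h₁ h₂) (fun j hj => absurd hj (Nat.not_lt_zero j)) hs

lemma InSnrt.lt_or_nonempty_iso {V : Type*} [Fintype V] {G : SimpleGraph V} {r t : ℕ}
    (hG : InSnrt G 9 r t) : ABCGG G < extremalValue ∨ Nonempty (G ≃g S33 2 0 2 0 0) := by
  classical
  obtain ⟨hcard, hconn, hedges, a, b, c₁, c₂, h₁, h₂, -, -, hone⟩ := hG
  obtain ⟨u, hu⟩ := Set.ncard_eq_one.1 hone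
  have hmem : ∀ v, v ∈ c₁.support ∧ v ∈ c₂.support ↔ v = u := fun v => by
    simpa using Set.ext_iff.1 hu v
  obtain ⟨hu₁, hu₂⟩ := (hmem u).2 rfl
  have hr₁ := h₁.rotate hu₁
  have hr₂ := h₂.rotate hu₂
  rcases le_total c₁.length c₂.length with hle | hle
  · refine lt_or_nonempty_iso_of_cycles hconn hcard hedges hr₁ hr₂ (fun v hv₁ hv₂ => ?_)
      (by simpa using hle)
    rw [SimpleGraph.Walk.mem_support_rotate_iff] at hv₁ hv₂
    exact (hmem v).1 ⟨hv₁, hv₂⟩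
  · refine lt_or_nonempty_iso_of_cycles hconn hcard hedges hr₂ hr₁ (fun v hv₂ hv₁ => ?_)
      (by simpa using hle)
    rw [SimpleGraph.Walk.mem_support_rotate_iff] at hv₁ hv₂
    exact (hmem v).1 ⟨hv₁, hv₂⟩

theorem stmt13 {V : Type*} [Fintype V] (G : SimpleGraph V) (r t : ℕ)
    (hr : 3 ≤ r) (ht : 3 ≤ t) (hG : InSnrt G 9 r t) :
    ABCGG G ≤ 2 * Real.sqrt (2 / 3) + 2 * Real.sqrt (6 / 15) + 2 * Real.sqrt (4 / 5) +
      4 * Real.sqrt (7 / 8) ∧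
    (ABCGG G = 2 * Real.sqrt (2 / 3) + 2 * Real.sqrt (6 / 15) + 2 * Real.sqrt (4 / 5) +
        4 * Real.sqrt (7 / 8) ↔
      Nonempty (G ≃g S33 2 0 2 0 0)) := by
  obtain ⟨hcard, hconn, hedges, -⟩ := id hG
  have hval := ABCGG_eq_extremalValue hconn hcard hedges
  change ABCGG G ≤ extremalValue ∧ (ABCGG G = extremalValue ↔ _)
  rcases hG.lt_or_nonempty_iso with hlt | ⟨⟨e⟩⟩
  · exact ⟨hlt.le, fun h => absurd h hlt.ne, fun ⟨e⟩ => hval e⟩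
  · exact ⟨(hval e).le, fun _ => ⟨e⟩, fun _ => hval e⟩
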